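/- (Moschovakis) Let (X, ν, d) be a computable metric space* in which ν is a numbering (onto), which admits an algorithm of passage to the limit, and which possesses a ν-computable sequence whose image is dense in (X,d). Then the open balls centered at computable points with computable radii, equipped with their natural numbering β, form both a Lacombe basis and a Nogina basis for (X, ν), and the Lacombe topology and the Nogina topology they generate are identical: there is a partial computable function translating every name of an open set for the Nogina topology into a name of the same set for the Lacombe topology, and conversely. -/

import Mathlib

namespace T1

/-- `phi e` : the `e`-th partial computable function `ℕ ⇀ ℕ`. -/
def phi (e : ℕ) : ℕ →. ℕ :=
  Nat.Partrec.Code.eval (Denumerable.ofNat Nat.Partrec.Code e)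

/-- `W e` : the `e`-th computably enumerable subset of `ℕ`. -/
def W (e : ℕ) : Set ℕ := (phi e).Dom

/-- A canonical numbering of the rationals. -/
def ratOfNat (k : ℕ) : ℚ := (Encodable.decode (α := ℚ) k).getD 0

/-- `e` is a name of `A ⊆ X` as a `ν`-semi-decidable set (a `ν_SD,m`-name):
`phi e` halts on a `ν`-name exactly when the named point belongs to `A`. -/
def SemiDecName {X : Type*} (ν : ℕ →. X) (A : Set X) (e : ℕ) : Prop :=
  ∀ i x, x ∈ ν i → ((phi e i).Dom ↔ x ∈ A)

/-- `f : X → Y` is `(ν,μ)`-computable. -/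
def Computes {X Y : Type*} (ν : ℕ →. X) (μ : ℕ →. Y) (f : X → Y) : Prop :=
  ∃ F : ℕ →. ℕ, Nat.Partrec F ∧ ∀ n x, x ∈ ν n → ∃ m ∈ F n, f x ∈ μ m

/-- `r` is a formal inclusion relation for the naming relation `β` of a family of
subsets of `X`: reflexive (on names), transitive, and implying actual inclusion. -/
structure IsFormalIncl {X : Type*} (β : ℕ → Set X → Prop) (r : ℕ → ℕ → Prop) : Prop where
  refl : ∀ n A, β n A → r n n
  trans : ∀ a b c, r a b → r b c → r a c
  mono : ∀ n m A B, r n m → β n A → β m B → A ⊆ B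

/-- Extension of a formal inclusion relation: a name vs. a sequence of names. -/
def SeqIncl (r : ℕ → ℕ → Prop) (b : ℕ) (s : ℕ → ℕ) : Prop := ∃ k, r b (s k)

/-- Extension of a formal inclusion relation: sequence vs. sequence. -/
def SeqIncl₂ (r : ℕ → ℕ → Prop) (s t : ℕ → ℕ) : Prop := ∀ p, SeqIncl r (s p) t

/-- The equivalence induced by the extended formal inclusion on sequences. -/
def SeqEquiv (r : ℕ → ℕ → Prop) (s t : ℕ → ℕ) : Prop := SeqIncl₂ r s t ∧ SeqIncl₂ r t s

/-- A Type 1 computable topological space `(X, ν, T, τ, r)`, where `τ` is a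
(single-valued) naming relation for open sets and `r` a formal inclusion relation. -/
structure IsCTS {X : Type*} (ν : ℕ →. X) (T : TopologicalSpace X)
    (τ : ℕ → Set X → Prop) (r : ℕ → ℕ → Prop) : Prop where
  single : ∀ n A B, τ n A → τ n B → A = B
  formal : IsFormalIncl τ r
  isOpen : ∀ n A, τ n A → T.IsOpen A
  generates : T = TopologicalSpace.generateFrom {A | ∃ n, τ n A}
  empty : ∃ n, τ n (∅ : Set X)
  univ : ∃ n, τ n (Set.univ : Set X)
  malcev : ∃ F : ℕ →. ℕ, Nat.Partrec F ∧ ∀ n A, τ n A → ∃ e ∈ F n, SemiDecName ν A e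
  union : ∃ U : ℕ →. ℕ, Nat.Partrec U ∧
    (∀ c (s : ℕ → ℕ) (A : ℕ → Set X), (∀ k, s k ∈ phi c k) → (∀ k, τ (s k) (A k)) →
      ∃ u ∈ U c, τ u (⋃ k, A k) ∧ ∀ k, r (s k) u) ∧
    (∀ c (s : ℕ → ℕ) (A : ℕ → Set X) c' (s' : ℕ → ℕ) (A' : ℕ → Set X),
      (∀ k, s k ∈ phi c k) → (∀ k, τ (s k) (A k)) →
      (∀ k, s' k ∈ phi c' k) → (∀ k, τ (s' k) (A' k)) →
      (∀ p, SeqIncl r (s p) s') →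
      ∀ u ∈ U c, ∀ u' ∈ U c', r u u')
  inter : ∃ I : ℕ →. ℕ, Nat.Partrec I ∧
    (∀ n₁ n₂ A₁ A₂, τ n₁ A₁ → τ n₂ A₂ → ∃ u ∈ I (Nat.pair n₁ n₂), τ u (A₁ ∩ A₂)) ∧
    (∀ n₁ n₂ A₁ A₂ n₁' n₂' A₁' A₂', τ n₁ A₁ → τ n₂ A₂ → τ n₁' A₁' → τ n₂' A₂' →
      r n₁ n₁' → r n₂ n₂' →
      ∀ u ∈ I (Nat.pair n₁ n₂), ∀ u' ∈ I (Nat.pair n₁' n₂'), r u u')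

/-- A Type 1 computable topological space with the actual inclusion relation as
formal inclusion (all monotonicity requirements are then automatic and omitted). -/
structure IsCTSIncl {X : Type*} (ν : ℕ →. X) (T : TopologicalSpace X)
    (τ : ℕ → Set X → Prop) : Prop where
  single : ∀ n A B, τ n A → τ n B → A = B
  isOpen : ∀ n A, τ n A → T.IsOpen A
  generates : T = TopologicalSpace.generateFrom {A | ∃ n, τ n A}
  empty : ∃ n, τ n (∅ : Set X)
  univ : ∃ n, τ n (Set.univ : Set X)
  malcev : ∃ F : ℕ →. ℕ, Nat.Partrec F ∧ ∀ n A, τ n A → ∃ e ∈ F n, SemiDecName ν A e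
  union : ∃ U : ℕ →. ℕ, Nat.Partrec U ∧
    ∀ c (s : ℕ → ℕ) (A : ℕ → Set X), (∀ k, s k ∈ phi c k) → (∀ k, τ (s k) (A k)) →
      ∃ u ∈ U c, τ u (⋃ k, A k)
  inter : ∃ I : ℕ →. ℕ, Nat.Partrec I ∧
    ∀ n₁ n₂ A₁ A₂, τ n₁ A₁ → τ n₂ A₂ → ∃ u ∈ I (Nat.pair n₁ n₂), τ u (A₁ ∩ A₂)

/-- A Nogina basis for `(X, ν)` (with `ν` intended to be a numbering, i.e. onto). -/
structure IsNoginaBasis {X : Type*} (ν : ℕ →. X) (β : ℕ → Set X → Prop) : Prop where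
  single : ∀ b B B', β b B → β b B' → B = B'
  semidec : ∃ F : ℕ →. ℕ, Nat.Partrec F ∧ ∀ b B, β b B → ∃ e ∈ F b, SemiDecName ν B e
  point : ∃ G : ℕ →. ℕ, Nat.Partrec G ∧
    ∀ n x, x ∈ ν n → ∃ b ∈ G n, ∃ B, β b B ∧ x ∈ B
  inter : ∃ H : ℕ →. ℕ, Nat.Partrec H ∧
    ∀ b₁ b₂ B₁ B₂ n x, β b₁ B₁ → β b₂ B₂ → x ∈ ν n → x ∈ B₁ → x ∈ B₂ →
      ∃ b₃ ∈ H (Nat.pair (Nat.pair b₁ b₂) n), ∃ B₃, β b₃ B₃ ∧ x ∈ B₃ ∧ B₃ ⊆ B₁ ∩ B₂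

/-- `p = ⟨e₁, e₂⟩` is a name of the open set `O` for the Nogina topology of the
basis `β`: `e₁` witnesses semi-decidability of `O` and `e₂` computes, from a
`ν`-name of a point of `O`, a basic set containing the point and contained in `O`. -/
def NoginaName {X : Type*} (ν : ℕ →. X) (β : ℕ → Set X → Prop) (p : ℕ) (O : Set X) : Prop :=
  SemiDecName ν O p.unpair.1 ∧
  ∀ n x, x ∈ ν n → x ∈ O → ∃ b ∈ phi p.unpair.2 n, ∃ B, β b B ∧ x ∈ B ∧ B ⊆ O

/-- `i` is a name of `O` as a Lacombe set: `W i ⊆ dom β` and `O` is the union of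
the basic sets named by elements of `W i`. -/
def LacombeName {X : Type*} (β : ℕ → Set X → Prop) (i : ℕ) (O : Set X) : Prop :=
  (∀ k ∈ W i, ∃ B, β k B) ∧ O = ⋃ k ∈ W i, ⋃ B, ⋃ (_ : β k B), B

/-- A Lacombe basis for `(X, ν)`. -/
structure IsLacombeBasis {X : Type*} (ν : ℕ →. X) (β : ℕ → Set X → Prop) : Prop where
  single : ∀ b B B', β b B → β b B' → B = B'
  semidec : ∃ F : ℕ →. ℕ, Nat.Partrec F ∧ ∀ b B, β b B → ∃ e ∈ F b, SemiDecName ν B e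
  point : ∀ x : X, ∃ b B, β b B ∧ x ∈ B
  cover : ∃ i, LacombeName β i (Set.univ : Set X)
  inter : ∃ H : ℕ →. ℕ, Nat.Partrec H ∧ ∀ b₁ b₂ B₁ B₂, β b₁ B₁ → β b₂ B₂ →
    ∃ i ∈ H (Nat.pair b₁ b₂), LacombeName β i (B₁ ∩ B₂)

/-- A Spreen basis for `(X, ν)`, with formal inclusion relation `r`.  Computable
functions with values in `dom(β)^ℕ` are represented by partial computable
functions producing the `k`-th term of the sequence from the pair `⟨input, k⟩`. -/
structure IsSpreenBasis {X : Type*} (ν : ℕ →. X) (β : ℕ → Set X → Prop)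
    (r : ℕ → ℕ → Prop) : Prop where
  single : ∀ b B B', β b B → β b B' → B = B'
  formal : IsFormalIncl β r
  semidec : ∃ F : ℕ →. ℕ, Nat.Partrec F ∧ ∀ b B, β b B → ∃ e ∈ F b, SemiDecName ν B e
  dense : ∀ b B, β b B → B.Nonempty → ∃ n x, x ∈ ν n ∧ x ∈ B
  G1 : ∃ g : ℕ →. ℕ, Nat.Partrec g ∧
    (∀ n x, x ∈ ν n → ∃ s : ℕ → ℕ, (∀ k, s k ∈ g (Nat.pair n k)) ∧
      ∀ k, ∃ B, β (s k) B ∧ x ∈ B) ∧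
    (∀ n m x (s t : ℕ → ℕ), x ∈ ν n → x ∈ ν m →
      (∀ k, s k ∈ g (Nat.pair n k)) → (∀ k, t k ∈ g (Nat.pair m k)) → SeqEquiv r s t) ∧
    (∀ x : X, ∃ b B, β b B ∧ x ∈ B ∧
      ∀ n y, y ∈ ν n → y ∈ B → ∀ s : ℕ → ℕ, (∀ k, s k ∈ g (Nat.pair n k)) → SeqIncl r b s)
  G2 : ∃ g : ℕ →. ℕ, Nat.Partrec g ∧
    (∀ n x b₁ b₂ B₁ B₂, x ∈ ν n → β b₁ B₁ → β b₂ B₂ → x ∈ B₁ → x ∈ B₂ →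
      ∃ s : ℕ → ℕ, (∀ k, s k ∈ g (Nat.pair (Nat.pair n (Nat.pair b₁ b₂)) k)) ∧
        ∀ k, ∃ B, β (s k) B ∧ x ∈ B ∧ B ⊆ B₁ ∩ B₂) ∧
    (∀ n m x b₁ b₂ b₁' b₂' (s t : ℕ → ℕ), x ∈ ν n → x ∈ ν m → r b₁ b₁' → r b₂ b₂' →
      (∀ k, s k ∈ g (Nat.pair (Nat.pair n (Nat.pair b₁ b₂)) k)) →
      (∀ k, t k ∈ g (Nat.pair (Nat.pair m (Nat.pair b₁' b₂')) k)) → SeqIncl₂ r s t) ∧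
    (∀ b₁ b₂ B₁ B₂, β b₁ B₁ → β b₂ B₂ → ∀ x, x ∈ B₁ → x ∈ B₂ →
      ∃ b₃ B₃, β b₃ B₃ ∧ x ∈ B₃ ∧
        ∀ m y, y ∈ ν m → y ∈ B₃ → ∀ s : ℕ → ℕ,
          (∀ k, s k ∈ g (Nat.pair (Nat.pair m (Nat.pair b₁ b₂)) k)) → SeqIncl r b₃ s)

/-- `p = ⟨n, m⟩` is a name of the open set `O` for the Spreen topology of the
Spreen basis `(β, r)`. -/
def SpreenName {X : Type*} (ν : ℕ →. X) (β : ℕ → Set X → Prop) (r : ℕ → ℕ → Prop)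
    (p : ℕ) (O : Set X) : Prop :=
  SemiDecName ν O p.unpair.1 ∧
  (∀ n x, x ∈ ν n → x ∈ O → ∃ s : ℕ → ℕ,
      (∀ k, s k ∈ phi p.unpair.2 (Nat.pair n k)) ∧
      ∀ k, ∃ B, β (s k) B ∧ x ∈ B ∧ B ⊆ O) ∧
  (∀ n m x (s t : ℕ → ℕ), x ∈ ν n → x ∈ ν m → x ∈ O →
      (∀ k, s k ∈ phi p.unpair.2 (Nat.pair n k)) →
      (∀ k, t k ∈ phi p.unpair.2 (Nat.pair m k)) → SeqEquiv r s t) ∧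
  (∀ x, x ∈ O → ∃ b B, β b B ∧ x ∈ B ∧
      ∀ n y, y ∈ ν n → y ∈ B → ∀ s : ℕ → ℕ,
        (∀ k, s k ∈ phi p.unpair.2 (Nat.pair n k)) → SeqIncl r b s)

/-- The extension of the formal inclusion relation `r` to names of Spreen open sets. -/
def SpreenTauIncl {X : Type*} (ν : ℕ →. X) (r : ℕ → ℕ → Prop) (p q : ℕ) : Prop :=
  ∀ n ∈ ν.Dom, (phi p.unpair.1 n).Dom →
    (phi q.unpair.1 n).Dom ∧
    ∀ s t : ℕ → ℕ, (∀ k, s k ∈ phi p.unpair.2 (Nat.pair n k)) →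
      (∀ k, t k ∈ phi q.unpair.2 (Nat.pair n k)) → SeqIncl₂ r s t

/-- A partial computable translation of Spreen names of open sets for the basis
`(β₁, r₁)` into Spreen names for the basis `(β₂, r₂)`, increasing with respect to
the extended formal inclusion relations. -/
def SpreenTopTrans {X : Type*} (ν : ℕ →. X) (β₁ : ℕ → Set X → Prop) (r₁ : ℕ → ℕ → Prop)
    (β₂ : ℕ → Set X → Prop) (r₂ : ℕ → ℕ → Prop) : Prop :=
  ∃ h : ℕ →. ℕ, Nat.Partrec h ∧
    (∀ p O, SpreenName ν β₁ r₁ p O → ∃ q ∈ h p, SpreenName ν β₂ r₂ q O) ∧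
    (∀ p p' O O', SpreenName ν β₁ r₁ p O → SpreenName ν β₁ r₁ p' O' →
      SpreenTauIncl ν r₁ p p' → ∀ q ∈ h p, ∀ q' ∈ h p', SpreenTauIncl ν r₂ q q')

/-- Effective continuity between computable topological spaces, with the actual
inclusion relations as formal inclusions. -/
def EffContinuous {X Y : Type*} (T₁ : TopologicalSpace X) (T₂ : TopologicalSpace Y)
    (τ₁ : ℕ → Set X → Prop) (τ₂ : ℕ → Set Y → Prop) (f : X → Y) : Prop :=
  (@Continuous X Y T₁ T₂ f) ∧
  ∃ h : ℕ →. ℕ, Nat.Partrec h ∧ ∀ n O, τ₂ n O → ∃ m ∈ h n, τ₁ m (f ⁻¹' O)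

/-- Effective continuity between computable topological spaces with formal
inclusion relations `r₁`, `r₂` on names of open sets. -/
def EffContinuousF {X Y : Type*} (T₁ : TopologicalSpace X) (T₂ : TopologicalSpace Y)
    (τ₁ : ℕ → Set X → Prop) (τ₂ : ℕ → Set Y → Prop)
    (r₁ r₂ : ℕ → ℕ → Prop) (f : X → Y) : Prop :=
  (@Continuous X Y T₁ T₂ f) ∧
  ∃ h : ℕ →. ℕ, Nat.Partrec h ∧
    (∀ n O, τ₂ n O → ∃ m ∈ h n, τ₁ m (f ⁻¹' O)) ∧
    (∀ n₁ n₂ O₁ O₂, τ₂ n₁ O₁ → τ₂ n₂ O₂ → r₂ n₁ n₂ →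
      ∀ m₁ ∈ h n₁, ∀ m₂ ∈ h n₂, r₁ m₁ m₂)

/-- `e` is a Cauchy name (`c_ℝ`-name) of the real number `x`. -/
def CRealName (e : ℕ) (x : ℝ) : Prop :=
  ∀ n : ℕ, ∃ m ∈ phi e n, |((ratOfNat m : ℚ) : ℝ) - x| < (2 : ℝ) ^ (-(n : ℤ))

/-- `e` is a left (lower) name (`c_↗`-name) of the real number `x`: it computes a
nondecreasing sequence of rationals below `x` converging to `x`. -/
def LRealName (e : ℕ) (x : ℝ) : Prop :=
  ∃ s : ℕ → ℕ, (∀ n, s n ∈ phi e n) ∧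
    (Monotone fun n => ratOfNat (s n)) ∧
    (∀ n, ((ratOfNat (s n) : ℚ) : ℝ) < x) ∧
    Filter.Tendsto (fun n => ((ratOfNat (s n) : ℚ) : ℝ)) Filter.atTop (nhds x)

/-- `(X, ν, d)` is a (non-necessarily effectively separable) computable metric
space: the computable points are dense and the metric is `(ν×ν, c_ℝ)`-computable. -/
structure IsCMS {X : Type*} [MetricSpace X] (ν : ℕ →. X) : Prop where
  dense : Dense {x : X | ∃ n, x ∈ ν n}
  dist_comp : ∃ F : ℕ →. ℕ, Nat.Partrec F ∧
    ∀ n m x y, x ∈ ν n → y ∈ ν m → ∃ e ∈ F (Nat.pair n m), CRealName e (dist x y)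

/-- The natural numbering of the open balls of a computable metric space, centered
at computable points with computable radii: `⟨n, m⟩` names `B(ν n, c_ℝ m)`. -/
def ballName {X : Type*} [MetricSpace X] (ν : ℕ →. X) (p : ℕ) (B : Set X) : Prop :=
  ∃ x r, x ∈ ν p.unpair.1 ∧ CRealName p.unpair.2 r ∧ B = Metric.ball x r

/-- The natural formal inclusion relation on names of balls:
`(x, r₁) ⊆̊ (y, r₂)` iff `d(x, y) + r₁ ≤ r₂`. -/
def ballIncl {X : Type*} [MetricSpace X] (ν : ℕ →. X) (p q : ℕ) : Prop :=
  ∃ x y r s, x ∈ ν p.unpair.1 ∧ y ∈ ν q.unpair.1 ∧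
    CRealName p.unpair.2 r ∧ CRealName q.unpair.2 s ∧ dist x y + r ≤ s

/-- `f` is effectively metric continuous: from a name of a point `x` and a name of
`ε > 0` one can compute a name of some `η > 0` witnessing continuity at `x`. -/
def EffMetricContinuous {X Y : Type*} [MetricSpace X] [MetricSpace Y]
    (ν : ℕ →. X) (f : X → Y) : Prop :=
  ∃ H : ℕ →. ℕ, Nat.Partrec H ∧
    ∀ n x e ε, x ∈ ν n → CRealName e ε → (0:ℝ) < ε →
      ∃ m ∈ H (Nat.pair n e), ∃ η : ℝ, CRealName m η ∧ 0 < η ∧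
        ∀ y : X, dist x y < η → dist (f x) (f y) < ε

/-- `(X, ν, d)` admits an algorithm of passage to the limit. -/
def HasLimitAlg {X : Type*} [MetricSpace X] (ν : ℕ →. X) : Prop :=
  ∃ L : ℕ →. ℕ, Nat.Partrec L ∧
    ∀ c (s : ℕ → ℕ) (xs : ℕ → X) (x : X),
      (∀ k, s k ∈ phi c k) → (∀ k, xs k ∈ ν (s k)) →
      (∀ k m, k < m → dist (xs k) (xs m) < (2 : ℝ) ^ (-(k : ℤ))) →
      Filter.Tendsto xs Filter.atTop (nhds x) →
      ∃ p ∈ L c, x ∈ ν p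



theorem intEquivNat_symm_eq (n : ℕ) :
    Equiv.intEquivNat.symm n = if n % 2 = 0 then (((n + 1) / 2 : ℕ) : ℤ) else -((n + 1) / 2 : ℕ) := by
  rw [Equiv.symm_apply_eq]
  obtain ⟨m, rfl | rfl⟩ := n.even_or_odd'
  · have h : (2 * m + 1) / 2 = m := by omega
    simp only [Nat.mul_mod_right, if_true, h]
    rfl
  · have h : (2 * m + 1 + 1) / 2 = m + 1 := by omega
    have h' : (2 * m + 1) % 2 ≠ 0 := by omega
    rw [if_neg h', h]
    rfl

theorem ratOfNat_eq (k : ℕ) :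
    ratOfNat k = if 0 < k.unpair.2 ∧ Nat.Coprime ((k.unpair.1 + 1) / 2) k.unpair.2 then
      ((Equiv.intEquivNat.symm k.unpair.1 : ℤ) : ℚ) / k.unpair.2 else 0 := by
  let : Encodable ℤ := Int.encodable
  have habs : (Equiv.intEquivNat.symm k.unpair.1).natAbs = (k.unpair.1 + 1) / 2 := by
    rw [intEquivNat_symm_eq]; split_ifs <;> omega
  have hdec : (Encodable.decode k.unpair.1 : Option ℤ) = some (Equiv.intEquivNat.symm k.unpair.1) :=
    rfl
  have hrat : (Encodable.decode k : Option ℚ) =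
      (Encodable.decode k : Option (Σ n : ℤ, {d : ℕ // 0 < d ∧ n.natAbs.Coprime d})).map
        fun s => ⟨s.1, s.2.1, s.2.2.1.ne', s.2.2.2⟩ :=
    (Encodable.decode_ofEquiv _ k).trans (by congr! with ⟨_, _, _, _⟩)
  rw [ratOfNat, hrat, Encodable.decode_sigma_val, hdec, ← habs]
  split_ifs with h
  · have : (Encodable.decode k.unpair.2 : Option {d : ℕ // 0 < d ∧
        (Equiv.intEquivNat.symm k.unpair.1).natAbs.Coprime d}) = some ⟨k.unpair.2, h⟩ := by
      show Encodable.decodeSubtype _ = _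
      rw [Encodable.decodeSubtype, Encodable.decode_nat, Option.bind_some, dif_pos h]
    simp only [Option.bind_some, this, Option.map_some, Option.getD_some]
    exact (Rat.num_div_den _).symm
  · have : (Encodable.decode k.unpair.2 : Option {d : ℕ // 0 < d ∧
        (Equiv.intEquivNat.symm k.unpair.1).natAbs.Coprime d}) = none := by
      show Encodable.decodeSubtype _ = _
      simp only [Encodable.decodeSubtype, Encodable.decode_nat, Option.bind_some]
      rw [dif_neg h]
    simp [this]

theorem coprime_iff_forall_lt (a d : ℕ) (hd : 0 < d) :
    Nat.Coprime a d ↔ ∀ x < d + 1, ¬ (1 < x ∧ a % x = 0 ∧ d % x = 0) := by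
  constructor
  · rintro h x - ⟨hx, ha, hd'⟩
    have := Nat.dvd_gcd (Nat.dvd_of_mod_eq_zero ha) (Nat.dvd_of_mod_eq_zero hd')
    rw [h] at this
    have := Nat.le_of_dvd one_pos this
    omega
  · intro h
    have hpos := Nat.gcd_pos_of_pos_right a hd
    have := h (a.gcd d) (Nat.lt_succ_of_le (Nat.le_of_dvd hd (Nat.gcd_dvd_right a d)))
    rw [Nat.coprime_iff_gcd_eq_one]
    by_contra hne
    exact this ⟨by omega, Nat.mod_eq_zero_of_dvd (Nat.gcd_dvd_left a d),
      Nat.mod_eq_zero_of_dvd (Nat.gcd_dvd_right a d)⟩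

theorem primrecPred_ratOfNat_valid :
    PrimrecPred fun k : ℕ => 0 < k.unpair.2 ∧ Nat.Coprime ((k.unpair.1 + 1) / 2) k.unpair.2 := by
  have hR : PrimrecRel fun x y : ℕ =>
      ¬ (1 < x ∧ ((y.unpair.1 + 1) / 2) % x = 0 ∧ y.unpair.2 % x = 0) := by
    have h1 : Primrec fun p : ℕ × ℕ => p.2.unpair := Primrec.unpair.comp Primrec.snd
    have ha : Primrec fun p : ℕ × ℕ => (p.2.unpair.1 + 1) / 2 :=
      Primrec.nat_div.comp (Primrec.succ.comp (Primrec.fst.comp h1)) (Primrec.const 2)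
    exact ((Primrec.nat_lt.comp (Primrec.const 1) Primrec.fst).and
      ((Primrec.eq.comp (Primrec.nat_mod.comp ha Primrec.fst) (Primrec.const 0)).and
        (Primrec.eq.comp (Primrec.nat_mod.comp (Primrec.snd.comp h1) Primrec.fst)
          (Primrec.const 0)))).not
  have h2 : Primrec fun k : ℕ => k.unpair.2 := Primrec.snd.comp Primrec.unpair
  refine ((Primrec.nat_lt.comp (Primrec.const 0) h2).and
    (hR.forall_lt.comp (Primrec.succ.comp h2) Primrec.id)).of_eq fun k => ?_
  exact and_congr_right fun h => (coprime_iff_forall_lt _ _ h).symm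

/-- The positive part of the numerator of `ratOfNat k`. -/
def posNum (k : ℕ) : ℕ :=
  if (0 < k.unpair.2 ∧ Nat.Coprime ((k.unpair.1 + 1) / 2) k.unpair.2) ∧ k.unpair.1 % 2 = 0 then
    (k.unpair.1 + 1) / 2 else 0

/-- The negative part of the numerator of `ratOfNat k`. -/
def negNum (k : ℕ) : ℕ :=
  if (0 < k.unpair.2 ∧ Nat.Coprime ((k.unpair.1 + 1) / 2) k.unpair.2) ∧ ¬ k.unpair.1 % 2 = 0 then
    (k.unpair.1 + 1) / 2 else 0

/-- A positive denominator of `ratOfNat k`. -/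
def posDen (k : ℕ) : ℕ := if 0 < k.unpair.2 then k.unpair.2 else 1

theorem primrec_posNum : Primrec posNum := by
  have h1 : Primrec fun k : ℕ => k.unpair.1 := Primrec.fst.comp Primrec.unpair
  exact Primrec.ite (primrecPred_ratOfNat_valid.and (Primrec.eq.comp
    (Primrec.nat_mod.comp h1 (Primrec.const 2)) (Primrec.const 0)))
    (Primrec.nat_div.comp (Primrec.succ.comp h1) (Primrec.const 2)) (Primrec.const 0)

theorem primrec_negNum : Primrec negNum := by
  have h1 : Primrec fun k : ℕ => k.unpair.1 := Primrec.fst.comp Primrec.unpair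
  exact Primrec.ite (primrecPred_ratOfNat_valid.and (Primrec.eq.comp
    (Primrec.nat_mod.comp h1 (Primrec.const 2)) (Primrec.const 0)).not)
    (Primrec.nat_div.comp (Primrec.succ.comp h1) (Primrec.const 2)) (Primrec.const 0)

theorem primrec_posDen : Primrec posDen := by
  have h2 : Primrec fun k : ℕ => k.unpair.2 := Primrec.snd.comp Primrec.unpair
  exact Primrec.ite (Primrec.nat_lt.comp (Primrec.const 0) h2) h2 (Primrec.const 1)

theorem posDen_pos (k : ℕ) : 0 < posDen k := by
  unfold posDen; split_ifs <;> omega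

theorem ratOfNat_eq_div (k : ℕ) :
    ratOfNat k = ((posNum k : ℚ) - negNum k) / posDen k := by
  rw [ratOfNat_eq, intEquivNat_symm_eq]
  unfold posNum negNum posDen
  generalize (k.unpair.1 + 1) / 2 = m
  by_cases h : 0 < k.unpair.2 ∧ Nat.Coprime m k.unpair.2
  · rw [if_pos h, if_pos h.1]
    by_cases h' : k.unpair.1 % 2 = 0
    · rw [if_pos h', if_pos ⟨h, h'⟩, if_neg fun hh => hh.2 h']
      simp
    · rw [if_neg h', if_neg fun hh => h' hh.2, if_pos ⟨h, h'⟩]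
      simp
  · simp [h]

/-- A code of the rational `2⁻ʲ`. -/
def twoPowNat (j : ℕ) : ℕ := Nat.pair 2 (2 ^ j)

theorem primrec_two_pow : Primrec fun j : ℕ => 2 ^ j :=
  (Primrec₂.unpaired'.1 Nat.Primrec.pow).comp (Primrec.const 2) Primrec.id

theorem primrec_twoPowNat : Primrec twoPowNat :=
  Primrec₂.natPair.comp (Primrec.const 2) primrec_two_pow

theorem ratOfNat_twoPowNat (j : ℕ) : ((ratOfNat (twoPowNat j) : ℚ) : ℝ) = (2 ^ j)⁻¹ := by
  simp [ratOfNat_eq, twoPowNat, intEquivNat_symm_eq]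

/-- The comparison `3 * 2⁻ᵏ < ratOfNat a - ratOfNat b`, with denominators cleared. -/
def GapTest (k a b : ℕ) : Prop :=
  (negNum a * posDen b + posNum b * posDen a) * 2 ^ k + 3 * (posDen a * posDen b) <
    (posNum a * posDen b + negNum b * posDen a) * 2 ^ k

instance (k a b : ℕ) : Decidable (GapTest k a b) := inferInstanceAs (Decidable (_ < _))

theorem gapTest_iff (k a b : ℕ) :
    GapTest k a b ↔ 3 * (2 ^ k : ℝ)⁻¹ < (ratOfNat a : ℚ) - (ratOfNat b : ℚ) := by
  have ha : (0 : ℝ) < posDen a := by exact_mod_cast posDen_pos a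
  have hb : (0 : ℝ) < posDen b := by exact_mod_cast posDen_pos b
  rw [GapTest, ← Nat.cast_lt (α := ℝ), ratOfNat_eq_div, ratOfNat_eq_div]
  push_cast
  rw [div_sub_div _ _ ha.ne' hb.ne', lt_div_iff₀ (by positivity), ← div_eq_mul_inv,
    div_mul_eq_mul_div, div_lt_iff₀ (by positivity)]
  constructor <;> intro h <;> nlinarith [h]

theorem primrecPred_gapTest : PrimrecPred fun p : ℕ × ℕ × ℕ => GapTest p.1 p.2.1 p.2.2 := by
  have ha : Primrec fun p : ℕ × ℕ × ℕ => p.2.1 := Primrec.fst.comp Primrec.snd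
  have hb : Primrec fun p : ℕ × ℕ × ℕ => p.2.2 := Primrec.snd.comp Primrec.snd
  have hk : Primrec fun p : ℕ × ℕ × ℕ => 2 ^ p.1 := primrec_two_pow.comp Primrec.fst
  have hA := primrec_posDen.comp ha
  have hB := primrec_posDen.comp hb
  exact Primrec.nat_lt.comp
    (Primrec.nat_add.comp (Primrec.nat_mul.comp (Primrec.nat_add.comp
      (Primrec.nat_mul.comp (primrec_negNum.comp ha) hB)
      (Primrec.nat_mul.comp (primrec_posNum.comp hb) hA)) hk)
      (Primrec.nat_mul.comp (Primrec.const 3) (Primrec.nat_mul.comp hA hB)))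
    (Primrec.nat_mul.comp (Primrec.nat_add.comp
      (Primrec.nat_mul.comp (primrec_posNum.comp ha) hB)
      (Primrec.nat_mul.comp (primrec_negNum.comp hb) hA)) hk)

theorem partrec₂_phi : Partrec₂ phi :=
  Nat.Partrec.Code.eval_part.comp ((Computable.ofNat Nat.Partrec.Code).comp Computable.fst)
    Computable.snd

theorem exists_phi_eq {f : ℕ →. ℕ} (hf : Partrec f) : ∃ e, phi e = f := by
  obtain ⟨c, hc⟩ := Nat.Partrec.Code.exists_code.1 (Partrec.nat_iff.1 hf)
  exact ⟨Encodable.encode c, by rw [phi, Denumerable.ofNat_encode, hc]⟩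

/-- The parametrized recursion theorem. -/
theorem exists_phi_fixed_point {f : ℕ → ℕ → ℕ →. ℕ}
    (hf : Partrec fun p : ℕ × ℕ × ℕ => f p.1 p.2.1 p.2.2) :
    ∃ s : ℕ → ℕ, Computable s ∧ ∀ a n, phi (s a) n = f (s a) a n := by
  have hcurry : Computable₂ fun (z : Nat.Partrec.Code) (a : ℕ) => Encodable.encode (z.curry a) :=
    Computable.encode.comp Nat.Partrec.Code.primrec₂_curry.to_comp
  have hg : Partrec₂ fun (z : Nat.Partrec.Code) (m : ℕ) =>
      f (Encodable.encode (z.curry m.unpair.1)) m.unpair.1 m.unpair.2 := by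
    have hm : Computable fun p : Nat.Partrec.Code × ℕ => p.2.unpair :=
      Computable.unpair.comp Computable.snd
    exact hf.comp ((hcurry.comp Computable.fst (Computable.fst.comp hm)).pair hm)
  obtain ⟨z, hz⟩ := Nat.Partrec.Code.fixed_point₂ hg
  refine ⟨fun a => Encodable.encode (z.curry a), hcurry.comp (Computable.const z) Computable.id,
    fun a n => ?_⟩
  conv_lhs => rw [phi, Denumerable.ofNat_encode, Nat.Partrec.Code.eval_curry, hz]
  simp

/-- The s-m-n theorem. -/
theorem exists_phi_param {f : ℕ → ℕ →. ℕ} (hf : Partrec₂ f) :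
    ∃ s : ℕ → ℕ, Computable s ∧ ∀ a n, phi (s a) n = f a n :=
  exists_phi_fixed_point (f := fun _ => f)
    (Partrec.comp (f := fun p : ℕ × ℕ => f p.1 p.2) hf Computable.snd)

/-- Dovetailing: one can search for an index at which a partial computable function halts. -/
theorem exists_partrec_search {g : ℕ → ℕ →. ℕ} (hg : Partrec₂ g) :
    ∃ S : ℕ →. ℕ, Partrec S ∧ ∀ a, (∀ v ∈ S a, ∃ k, v ∈ g a k) ∧
      ∀ k, (g a k).Dom → (S a).Dom := by
  obtain ⟨c, hc⟩ := Nat.Partrec.Code.exists_code.1 (Partrec₂.unpaired'.2 hg)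
  have hc' : ∀ a k, c.eval (Nat.pair a k) = g a k := by simp [hc]
  refine ⟨fun a => Nat.rfindOpt fun n =>
    Nat.Partrec.Code.evaln n.unpair.2 c (Nat.pair a n.unpair.1), ?_, fun a => ⟨?_, ?_⟩⟩
  · have hn : Computable fun p : ℕ × ℕ => p.2.unpair := Computable.unpair.comp Computable.snd
    exact Partrec.rfindOpt (Nat.Partrec.Code.primrec_evaln.to_comp.comp
      (((Computable.snd.comp hn).pair (Computable.const c)).pair
        (Primrec₂.natPair.to_comp.comp Computable.fst (Computable.fst.comp hn))))
  · intro v hv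
    obtain ⟨n, hn⟩ := Nat.rfindOpt_spec hv
    exact ⟨n.unpair.1, by rw [← hc']; exact Nat.Partrec.Code.evaln_sound hn⟩
  · intro k hk
    obtain ⟨v, hv⟩ := Part.dom_iff_mem.1 hk
    rw [← hc'] at hv
    obtain ⟨t, ht⟩ := Nat.Partrec.Code.evaln_complete.1 hv
    exact Nat.rfindOpt_dom.2 ⟨Nat.pair k t, v, by simpa using ht⟩

/-- The union of the values of a partial computable function is uniformly computably enumerable. -/
theorem exists_W_eq_range {g : ℕ → ℕ →. ℕ} (hg : Partrec₂ g) :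
    ∃ s : ℕ → ℕ, Computable s ∧ ∀ a, W (s a) = {v | ∃ k, v ∈ g a k} := by
  have hg' : Partrec₂ fun (m k : ℕ) => (g m.unpair.1 k).bind fun w =>
      Nat.rfind fun _ => Part.some (decide (w = m.unpair.2)) := by
    have hm : Computable fun p : ℕ × ℕ => p.1.unpair := Computable.unpair.comp Computable.fst
    refine Partrec.bind (hg.comp (Computable.fst.comp hm) Computable.snd) ?_
    refine Partrec.rfind (Computable.partrec ?_)
    exact (Primrec.eq.decide.to_comp.comp (Computable.snd.comp Computable.fst)
      (Computable.snd.comp (hm.comp (Computable.fst.comp Computable.fst))))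
  obtain ⟨S, hS, hSg⟩ := exists_partrec_search hg'
  obtain ⟨s, hs, hsS⟩ := exists_phi_param (f := fun a v => S (Nat.pair a v))
    (hS.comp Primrec₂.natPair.to_comp)
  refine ⟨s, hs, fun a => Set.ext fun v => ?_⟩
  have hW : v ∈ W (s a) ↔ (S (Nat.pair a v)).Dom := by
    rw [← hsS]; exact Iff.rfl
  rw [hW, Set.mem_ofPred_eq]
  constructor
  · intro h
    obtain ⟨k, hk⟩ := (hSg _).1 _ (Part.get_mem h)
    obtain ⟨w, hw, hr⟩ := Part.mem_bind_iff.1 hk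
    have := Nat.rfind_spec hr
    simp only [Nat.unpair_pair, Part.mem_some_iff, true_eq_decide_iff] at this hw
    exact ⟨k, this ▸ hw⟩
  · rintro ⟨k, hk⟩
    refine (hSg _).2 k ?_
    rw [Part.bind_dom]
    simp only [Nat.unpair_pair]
    refine ⟨Part.dom_iff_mem.2 ⟨v, hk⟩, Nat.rfind_dom.2 ⟨0, ?_, by simp⟩⟩
    simp [Part.get_eq_of_mem hk]

theorem bounded_bind_dom_iff (st : ℕ →. ℕ) (M : ℕ) :
    (Nat.rec (Part.some 0) (fun a IH => IH.bind fun _ => st a) M : Part ℕ).Dom ↔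
      ∀ a < M, (st a).Dom := by
  induction M with
  | zero => simp
  | succ M ih =>
    simp only [Part.bind_dom, exists_prop, ih, Nat.lt_succ_iff_lt_or_eq]
    constructor
    · rintro ⟨h, h'⟩ a (ha | rfl)
      exacts [h a ha, h']
    · exact fun h => ⟨fun a ha => h a (.inl ha), h M (.inr rfl)⟩

theorem partrec_bounded_bind {α : Type*} [Primcodable α] {st : α → ℕ →. ℕ} {M : α → ℕ}
    (hst : Partrec₂ st) (hM : Computable M) : Partrec fun x =>
      (Nat.rec (Part.some 0) (fun a IH => IH.bind fun _ => st x a) (M x) : Part ℕ) :=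
  Partrec.nat_rec (h := fun x (p : ℕ × ℕ) => st x p.1) hM (Computable.const 0).partrec
    (hst.comp Computable.fst (Computable.fst.comp Computable.snd))

theorem CRealName.exists_abs_sub_lt {e : ℕ} {r : ℝ} (h : CRealName e r) (n : ℕ) :
    ∃ m ∈ phi e n, |((ratOfNat m : ℚ) : ℝ) - r| < (2 ^ n : ℝ)⁻¹ := by
  simpa [zpow_neg] using h n

theorem CRealName.unique {e : ℕ} {r s : ℝ} (hr : CRealName e r) (hs : CRealName e s) : r = s := by
  refine eq_of_abs_sub_le_all fun ε hε => ?_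
  obtain ⟨n, hn⟩ := exists_pow_lt_of_lt_one (half_pos hε) (by norm_num : (2⁻¹ : ℝ) < 1)
  rw [inv_pow] at hn
  obtain ⟨m, hm, h⟩ := hr.exists_abs_sub_lt n
  obtain ⟨m', hm', h'⟩ := hs.exists_abs_sub_lt n
  obtain rfl := Part.mem_unique hm hm'
  rw [abs_lt] at h h'
  rw [abs_le]
  constructor <;> linarith

theorem exists_two_pow_names :
    ∃ ρ : ℕ → ℕ, Computable ρ ∧ ∀ j, CRealName (ρ j) (2 ^ j : ℝ)⁻¹ := by
  obtain ⟨s, hs, h⟩ := exists_phi_param (f := fun j _ => Part.some (twoPowNat j))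
    (Computable.partrec (primrec_twoPowNat.to_comp.comp Computable.fst))
  refine ⟨s, hs, fun j n => ⟨twoPowNat j, by simp [h], ?_⟩⟩
  rw [ratOfNat_twoPowNat, sub_self, abs_zero]
  positivity

section

variable {X : Type*} [MetricSpace X] {ν : ℕ →. X}

theorem ballName_unique {b : ℕ} {B B' : Set X} (h : ballName ν b B) (h' : ballName ν b B') :
    B = B' := by
  obtain ⟨x, r, hx, hr, rfl⟩ := h
  obtain ⟨x', r', hx', hr', rfl⟩ := h'
  rw [Part.mem_unique hx hx', hr.unique hr']

/-- `G b i` halts exactly when the point named `i` lies in the ball named `b`; the value `j` then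
bounds from below by `2⁻ʲ` the distance left to the boundary. -/
def IsMargin (ν : ℕ →. X) (G : ℕ → ℕ →. ℕ) : Prop :=
  ∀ b i x y r, x ∈ ν b.unpair.1 → CRealName b.unpair.2 r → y ∈ ν i →
    (∀ j ∈ G b i, dist y x + (2 ^ j : ℝ)⁻¹ < r) ∧ (dist y x < r → (G b i).Dom)

theorem IsCMS.exists_isMargin (h : IsCMS ν) : ∃ G, Partrec₂ G ∧ IsMargin ν G := by
  obtain ⟨F, hF, hFd⟩ := h.dist_comp
  refine ⟨fun b i => (F (Nat.pair b.unpair.1 i)).bind fun e =>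
    Nat.rfind fun k => (phi b.unpair.2 k).bind fun a =>
      (phi e k).map fun c => decide (GapTest k a c), ?_, ?_⟩
  · have hb : Computable fun p : ℕ × ℕ => p.1.unpair := Computable.unpair.comp Computable.fst
    have hgap : Computable₂ fun (q : (((ℕ × ℕ) × ℕ) × ℕ) × ℕ) c =>
        decide (GapTest q.1.2 q.2 c) := by
      have hargs : Computable fun p : ((((ℕ × ℕ) × ℕ) × ℕ) × ℕ) × ℕ => (p.1.1.2, p.1.2, p.2) :=
        (Computable.snd.comp (Computable.fst.comp Computable.fst)).pair
          ((Computable.snd.comp Computable.fst).pair Computable.snd)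
      have h := primrecPred_gapTest.decide.to_comp.comp hargs
      exact h
    have hphi : Partrec fun q : (((ℕ × ℕ) × ℕ) × ℕ) × ℕ => phi q.1.1.2 q.1.2 :=
      partrec₂_phi.comp (Computable.snd.comp (Computable.fst.comp Computable.fst))
        (Computable.snd.comp Computable.fst)
    have hrad : Partrec fun q : ((ℕ × ℕ) × ℕ) × ℕ => phi q.1.1.1.unpair.2 q.2 :=
      partrec₂_phi.comp (Computable.snd.comp (hb.comp (Computable.fst.comp Computable.fst)))
        Computable.snd
    exact Partrec.bind ((Partrec.nat_iff.2 hF).comp (Primrec₂.natPair.to_comp.comp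
      (Computable.fst.comp hb) Computable.snd)) (Partrec.rfind (hrad.bind (hphi.map hgap)))
  · intro b i x y r hx hr hy
    obtain ⟨e, he, hd⟩ := hFd _ _ _ _ hx hy
    beta_reduce
    rw [Part.eq_some_iff.2 he, Part.bind_some, dist_comm y x]
    choose qr hqr hqr' using hr.exists_abs_sub_lt
    choose qd hqd hqd' using hd.exists_abs_sub_lt
    have hval : ∀ k, ((phi b.unpair.2 k).bind fun a =>
        (phi e k).map fun c => decide (GapTest k a c)) =
          Part.some (decide (GapTest k (qr k) (qd k))) := fun k => by
      rw [Part.eq_some_iff.2 (hqr k), Part.bind_some, Part.eq_some_iff.2 (hqd k), Part.map_some]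
    simp only [hval]
    constructor
    · intro j hj
      have h1 := Nat.rfind_spec hj
      rw [Part.mem_some_iff, true_eq_decide_iff, gapTest_iff] at h1
      have h2 := hqr' j
      have h3 := hqd' j
      rw [abs_lt] at h2 h3
      linarith
    · intro hlt
      obtain ⟨k, hk⟩ := exists_pow_lt_of_lt_one (div_pos (sub_pos.2 hlt) (by norm_num : (0 : ℝ) < 5))
        (by norm_num : (2⁻¹ : ℝ) < 1)
      rw [inv_pow] at hk
      refine Nat.rfind_dom.2 ⟨k, ?_, fun _ => trivial⟩
      rw [Part.mem_some_iff, true_eq_decide_iff, gapTest_iff]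
      have h2 := hqr' k
      have h3 := hqd' k
      rw [abs_lt] at h2 h3
      linarith

/-- On a name of a point `x`, `phi e` halts exactly when `x ∈ O`, and then returns `j` such that
the ball of radius `2⁻ʲ` around `x` is contained in `O`. -/
def NbhdName (ν : ℕ →. X) (O : Set X) (e : ℕ) : Prop :=
  ∀ n x, x ∈ ν n → ((phi e n).Dom ↔ x ∈ O) ∧ ∀ j ∈ phi e n, Metric.ball x (2 ^ j : ℝ)⁻¹ ⊆ O

theorem NbhdName.semiDecName {O : Set X} {e : ℕ} (h : NbhdName ν O e) : SemiDecName ν O e :=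
  fun n x hx => (h n x hx).1

theorem exists_nbhdName_univ : ∃ e, NbhdName ν Set.univ e := by
  obtain ⟨e, he⟩ := exists_phi_eq Partrec.some
  refine ⟨e, fun n x _ => ⟨?_, fun j _ => Set.subset_univ _⟩⟩
  simp [he]

theorem IsMargin.mem_iff {G : ℕ → ℕ →. ℕ} (hG : IsMargin ν G) {b n : ℕ} {B : Set X} {x : X}
    (hb : ballName ν b B) (hx : x ∈ ν n) : (G b n).Dom ↔ x ∈ B := by
  obtain ⟨y, r, hy, hr, rfl⟩ := hb
  refine ⟨fun h => ?_, (hG b n y x r hy hr hx).2⟩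
  have := (hG b n y x r hy hr hx).1 _ (Part.get_mem h)
  have : (0 : ℝ) < (2 ^ (G b n).get h)⁻¹ := by positivity
  rw [Metric.mem_ball]
  linarith

theorem IsMargin.ball_subset {G : ℕ → ℕ →. ℕ} (hG : IsMargin ν G) {b n j : ℕ} {B : Set X} {x : X}
    (hb : ballName ν b B) (hx : x ∈ ν n) (hj : j ∈ G b n) :
    Metric.ball x (2 ^ j : ℝ)⁻¹ ⊆ B := by
  obtain ⟨y, r, hy, hr, rfl⟩ := hb
  have := (hG b n y x r hy hr hx).1 j hj
  exact Metric.ball_subset_ball' (by linarith)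

theorem IsMargin.exists_nbhdName_ball {G : ℕ → ℕ →. ℕ} (hGc : Partrec₂ G) (hG : IsMargin ν G) :
    ∃ t : ℕ → ℕ, Computable t ∧ ∀ b B, ballName ν b B → NbhdName ν B (t b) := by
  obtain ⟨s, hs, hsG⟩ := exists_phi_param hGc
  refine ⟨s, hs, fun b B hb n x hx => ?_⟩
  rw [hsG]
  exact ⟨hG.mem_iff hb hx, fun j hj => hG.ball_subset hb hx hj⟩

theorem exists_nbhdName_inter : ∃ t : ℕ → ℕ → ℕ, Computable₂ t ∧ ∀ (e₁ e₂ : ℕ) (O₁ O₂ : Set X),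
    NbhdName ν O₁ e₁ → NbhdName ν O₂ e₂ → NbhdName ν (O₁ ∩ O₂) (t e₁ e₂) := by
  have hf : Partrec₂ fun p n : ℕ =>
      (phi p.unpair.1 n).bind fun i => (phi p.unpair.2 n).map fun j => i + j := by
    have hp : Computable fun q : ℕ × ℕ => q.1.unpair := Computable.unpair.comp Computable.fst
    refine Partrec.bind (partrec₂_phi.comp (Computable.fst.comp hp) Computable.snd) ?_
    exact Partrec.map (partrec₂_phi.comp (Computable.snd.comp (hp.comp Computable.fst))
      (Computable.snd.comp Computable.fst))
      (Primrec.nat_add.to_comp.comp (Computable.snd.comp Computable.fst) Computable.snd)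
  obtain ⟨s, hs, hsf⟩ := exists_phi_param hf
  refine ⟨fun e₁ e₂ => s (Nat.pair e₁ e₂), hs.comp₂ Primrec₂.natPair.to_comp,
    fun e₁ e₂ O₁ O₂ h₁ h₂ n x hx => ?_⟩
  obtain ⟨hd₁, hv₁⟩ := h₁ n x hx
  obtain ⟨hd₂, hv₂⟩ := h₂ n x hx
  simp only [hsf, Nat.unpair_pair]
  refine ⟨by simp [Part.bind_dom, hd₁, hd₂], fun v hv => ?_⟩
  obtain ⟨i, hi, hv⟩ := Part.mem_bind_iff.1 hv
  obtain ⟨j, hj, rfl⟩ := (Part.mem_map_iff _).1 hv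
  refine Set.subset_inter ((Metric.ball_subset_ball ?_).trans (hv₁ i hi))
    ((Metric.ball_subset_ball ?_).trans (hv₂ j hj))
  · exact inv_anti₀ (by positivity) (pow_le_pow_right₀ one_le_two (by omega))
  · exact inv_anti₀ (by positivity) (pow_le_pow_right₀ one_le_two (by omega))

theorem IsMargin.exists_nbhdName_of_noginaName {G : ℕ → ℕ →. ℕ} (hGc : Partrec₂ G)
    (hG : IsMargin ν G) : ∃ t : ℕ → ℕ, Computable t ∧
      ∀ p O, NoginaName ν (ballName ν) p O → NbhdName ν O (t p) := by
  have hf : Partrec₂ fun p n : ℕ => (phi p.unpair.1 n).bind fun _ =>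
      (phi p.unpair.2 n).bind fun b => G b n := by
    have hp : Computable fun q : ℕ × ℕ => q.1.unpair := Computable.unpair.comp Computable.fst
    refine Partrec.bind (partrec₂_phi.comp (Computable.fst.comp hp) Computable.snd) ?_
    refine Partrec.bind (partrec₂_phi.comp (Computable.snd.comp (hp.comp Computable.fst))
      (Computable.snd.comp Computable.fst)) ?_
    exact hGc.comp Computable.snd (Computable.snd.comp (Computable.fst.comp Computable.fst))
  obtain ⟨s, hs, hsf⟩ := exists_phi_param hf
  refine ⟨s, hs, fun p O ⟨hd, hb⟩ n x hx => ?_⟩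
  rw [hsf]
  constructor
  · refine ⟨fun h => (hd n x hx).1 (Part.bind_dom.1 h).1, fun h => ?_⟩
    obtain ⟨b, hbn, B, hB, hxB, -⟩ := hb n x hx h
    refine Part.bind_dom.2 ⟨(hd n x hx).2 h, ?_⟩
    rw [Part.eq_some_iff.2 hbn, Part.bind_some]
    exact (hG.mem_iff hB hx).2 hxB
  · intro j hj
    obtain ⟨m, hm, hj⟩ := Part.mem_bind_iff.1 hj
    obtain ⟨b, hbn, B, hB, hxB, hBO⟩ := hb n x hx ((hd n x hx).1 (Part.dom_iff_mem.2 ⟨m, hm⟩))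
    rw [Part.eq_some_iff.2 hbn, Part.bind_some] at hj
    exact (hG.ball_subset hB hx hj).trans hBO

theorem ballName_pair {ρ : ℕ → ℕ} (hρ : ∀ j, CRealName (ρ j) (2 ^ j : ℝ)⁻¹) {n : ℕ} {x : X}
    (hx : x ∈ ν n) (j : ℕ) : ballName ν (Nat.pair n (ρ j)) (Metric.ball x (2 ^ j : ℝ)⁻¹) :=
  ⟨x, _, by simpa using hx, by simpa using hρ j, rfl⟩

theorem exists_noginaName_of_nbhdName : ∃ t : ℕ → ℕ, Computable t ∧
    ∀ (e : ℕ) (O : Set X), NbhdName ν O e → NoginaName ν (ballName ν) (t e) O := by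
  obtain ⟨ρ, hρc, hρ⟩ := exists_two_pow_names
  obtain ⟨s, hs, hsf⟩ := exists_phi_param
    (f := fun e n => (phi e n).map fun j => Nat.pair n (ρ j))
    (Partrec.map partrec₂_phi (Primrec₂.natPair.to_comp.comp
      (Computable.snd.comp Computable.fst) (hρc.comp Computable.snd)))
  refine ⟨fun e => Nat.pair e (s e), Primrec₂.natPair.to_comp.comp Computable.id hs,
    fun e O h => ⟨?_, fun n x hx hxO => ?_⟩⟩
  · simpa using h.semiDecName
  · obtain ⟨j, hj⟩ := Part.dom_iff_mem.1 ((h n x hx).1.2 hxO)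
    refine ⟨Nat.pair n (ρ j), ?_, _, ballName_pair hρ hx j, Metric.mem_ball_self (by positivity),
      (h n x hx).2 j hj⟩
    simpa only [Nat.unpair_pair, hsf] using Part.mem_map (fun j => Nat.pair n (ρ j)) hj

theorem IsMargin.exists_nbhdName_of_lacombeName {G : ℕ → ℕ →. ℕ} (hGc : Partrec₂ G)
    (hG : IsMargin ν G) : ∃ t : ℕ → ℕ, Computable t ∧
      ∀ i O, LacombeName (ballName ν) i O → NbhdName ν O (t i) := by
  have hf : Partrec₂ fun p k : ℕ => (phi p.unpair.1 k).bind fun _ => G k p.unpair.2 := by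
    have hp : Computable fun q : ℕ × ℕ => q.1.unpair := Computable.unpair.comp Computable.fst
    refine Partrec.bind (partrec₂_phi.comp (Computable.fst.comp hp) Computable.snd) ?_
    exact hGc.comp (Computable.snd.comp Computable.fst)
      (Computable.snd.comp (hp.comp Computable.fst))
  obtain ⟨S, hS, hSf⟩ := exists_partrec_search hf
  obtain ⟨s, hs, hsS⟩ := exists_phi_param (f := fun i n => S (Nat.pair i n))
    (hS.comp Primrec₂.natPair.to_comp)
  refine ⟨s, hs, fun i O ⟨hi, hO⟩ n x hx => ?_⟩
  have hsub : ∀ k B, k ∈ W i → ballName ν k B → B ⊆ O := fun k B hk hB y hy => by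
    rw [hO]; simp only [Set.mem_iUnion]; exact ⟨k, hk, B, hB, hy⟩
  have hval : ∀ j ∈ phi (s i) n, Metric.ball x (2 ^ j : ℝ)⁻¹ ⊆ O := by
    intro j hj
    rw [hsS] at hj
    obtain ⟨k, hk⟩ := (hSf _).1 j hj
    obtain ⟨m, hm, hj⟩ := Part.mem_bind_iff.1 hk
    rw [Nat.unpair_pair] at hm hj
    have hkW : k ∈ W i := Part.dom_iff_mem.2 ⟨m, hm⟩
    obtain ⟨B, hB⟩ := hi k hkW
    exact (hG.ball_subset hB hx hj).trans (hsub k B hkW hB)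
  refine ⟨⟨fun h => hval _ (Part.get_mem h) (Metric.mem_ball_self (by positivity)), fun h => ?_⟩,
    hval⟩
  rw [hO] at h
  simp only [Set.mem_iUnion] at h
  obtain ⟨k, hk, B, hB, hxB⟩ := h
  rw [hsS]
  refine (hSf _).2 k (Part.bind_dom.2 ⟨?_, ?_⟩)
  · rw [Nat.unpair_pair]; exact hk
  · simpa using (hG.mem_iff hB hx).2 hxB

/-- By the recursion theorem there are codes `s e c` which copy `phi c` until `Q e (s e c)` is
seen to halt, at some stage `t` with value `j`, and which are constantly equal to the term of
index `t + j` of `phi c` from then on. -/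
theorem exists_phi_freeze {Q : ℕ → ℕ →. ℕ} (hQ : Partrec₂ Q) :
    ∃ s : ℕ → ℕ → ℕ, Computable₂ s ∧ ∃ M : ℕ → ℕ →. ℕ, Partrec₂ M ∧ ∀ e c,
      ((M e c).Dom → (Q e (s e c)).Dom) ∧
      (¬ (Q e (s e c)).Dom → ∀ i, phi (s e c) i = phi c i) ∧
      ∀ j ∈ Q e (s e c), ∃ t, t + j ∈ M e c ∧
        ∀ i, phi (s e c) i = phi c (if t ≤ i then t + j else i) := by
  obtain ⟨q, hq⟩ := Nat.Partrec.Code.exists_code.1 (Partrec₂.unpaired'.2 hQ)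
  have hq' : ∀ e z, q.eval (Nat.pair e z) = Q e z := by simp [hq]
  let hal (e z i : ℕ) : Bool := (Nat.Partrec.Code.evaln i q (Nat.pair e z)).isSome
  have hhal : Computable fun p : (ℕ × ℕ) × ℕ => hal p.1.1 p.1.2 p.2 :=
    Primrec.option_isSome.to_comp.comp (Nat.Partrec.Code.primrec_evaln.to_comp.comp
      ((Computable.snd.pair (Computable.const q)).pair
        (Primrec₂.natPair.to_comp.comp (Computable.fst.comp Computable.fst)
          (Computable.snd.comp Computable.fst))))
  let N (e z : ℕ) : Part ℕ :=
    (Nat.rfind fun i => Part.some (hal e z i)).bind fun t => (Q e z).map fun j => t + j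
  have hN : Partrec₂ N := by
    refine Partrec.bind (Partrec.rfind hhal.partrec) ?_
    exact Partrec.map (hQ.comp (Computable.fst.comp Computable.fst)
      (Computable.snd.comp Computable.fst))
      (Primrec.nat_add.to_comp.comp (Computable.snd.comp Computable.fst) Computable.snd)
  have hf : Partrec fun p : ℕ × ℕ × ℕ =>
      (cond (hal p.2.1.unpair.1 p.1 p.2.2) (N p.2.1.unpair.1 p.1) (Part.some p.2.2)).bind
        fun k => phi p.2.1.unpair.2 k := by
    have ha : Computable fun p : ℕ × ℕ × ℕ => p.2.1.unpair :=
      Computable.unpair.comp (Computable.fst.comp Computable.snd)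
    have hez : Computable fun p : ℕ × ℕ × ℕ => (p.2.1.unpair.1, p.1) :=
      (Computable.fst.comp ha).pair Computable.fst
    have hezi : Computable fun p : ℕ × ℕ × ℕ => ((p.2.1.unpair.1, p.1), p.2.2) :=
      hez.pair (Computable.snd.comp Computable.snd)
    have hc := hhal.comp hezi
    have hN' := Partrec.comp (f := fun p : ℕ × ℕ => N p.1 p.2) hN hez
    have hi : Partrec fun p : ℕ × ℕ × ℕ => Part.some p.2.2 :=
      Computable.partrec (Computable.snd.comp Computable.snd)
    have hphi : Partrec₂ fun (p : ℕ × ℕ × ℕ) k => phi p.2.1.unpair.2 k :=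
      partrec₂_phi.comp (Computable.snd.comp (ha.comp Computable.fst)) Computable.snd
    exact (Partrec.cond hc hN' hi).bind hphi
  obtain ⟨s, hs, hsf⟩ := exists_phi_fixed_point (f := fun z a i =>
    (cond (hal a.unpair.1 z i) (N a.unpair.1 z) (Part.some i)).bind fun k => phi a.unpair.2 k) hf
  have hs₂ : Computable₂ fun e c => s (Nat.pair e c) := hs.comp₂ Primrec₂.natPair.to_comp
  refine ⟨fun e c => s (Nat.pair e c), hs₂, fun e c => N e (s (Nat.pair e c)),
    hN.comp Computable.fst hs₂, fun e c => ?_⟩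
  have hval : ∀ i, phi (s (Nat.pair e c)) i =
      (cond (hal e (s (Nat.pair e c)) i) (N e (s (Nat.pair e c))) (Part.some i)).bind
        fun k => phi c k := by
    intro i; rw [hsf, Nat.unpair_pair]
  beta_reduce
  generalize s (Nat.pair e c) = z at hval ⊢
  refine ⟨fun h => ?_, fun h i => ?_, fun j hj => ?_⟩
  · obtain ⟨v, hv⟩ := Part.dom_iff_mem.1 h
    obtain ⟨t, -, hv⟩ := Part.mem_bind_iff.1 hv
    obtain ⟨j, hj, -⟩ := (Part.mem_map_iff _).1 hv
    exact Part.dom_iff_mem.2 ⟨j, hj⟩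
  · have : hal e z i = false := by
      rw [Bool.eq_false_iff]
      intro hi
      obtain ⟨v, hv⟩ := Option.isSome_iff_exists.1 hi
      exact h (hq' e z ▸ Part.dom_iff_mem.2 ⟨v, Nat.Partrec.Code.evaln_sound hv⟩)
    rw [hval, this, cond_false, Part.bind_some]
  · obtain ⟨i₀, hi₀⟩ := Nat.Partrec.Code.evaln_complete.1 (hq' e z ▸ hj)
    have hdom : (Nat.rfind fun i => Part.some (hal e z i)).Dom :=
      Nat.rfind_dom.2 ⟨i₀, Part.mem_some_iff.2 (Option.isSome_iff_exists.2 ⟨j, hi₀⟩).symm,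
        fun _ => trivial⟩
    obtain ⟨t, ht⟩ := Part.dom_iff_mem.1 hdom
    have hNt : t + j ∈ N e z := Part.mem_bind ht (Part.mem_map _ hj)
    have hti : ∀ i, hal e z i = decide (t ≤ i) := by
      intro i
      by_cases h : t ≤ i
      · obtain ⟨v, hv⟩ := Option.isSome_iff_exists.1 (Part.mem_some_iff.1 (Nat.rfind_spec ht)).symm
        rw [decide_eq_true h]
        exact Option.isSome_iff_exists.2 ⟨v, Nat.Partrec.Code.evaln_mono h hv⟩
      · rw [decide_eq_false h]
        exact (Part.mem_some_iff.1 (Nat.rfind_min ht (not_le.1 h))).symm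
    refine ⟨t, hNt, fun i => ?_⟩
    rw [hval, hti]
    by_cases h : t ≤ i
    · rw [decide_eq_true h, if_pos h, cond_true, Part.eq_some_iff.2 hNt, Part.bind_some]
    · rw [decide_eq_false h, if_neg h, cond_false, Part.bind_some]

theorem dist_le_of_dist_succ_lt {f : ℕ → X} {M : ℕ}
    (hf : ∀ a < M, dist (f (a + 1)) (f a) < (2 ^ (a + 1) : ℝ)⁻¹) {a b : ℕ} (hab : a ≤ b)
    (hb : b ≤ M) : dist (f a) (f b) ≤ (2 ^ a : ℝ)⁻¹ - (2 ^ b : ℝ)⁻¹ := by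
  induction b, hab using Nat.le_induction with
  | base => simp
  | succ b hab ih =>
    have h1 := ih (by omega)
    have h2 := hf b (by omega)
    have h3 := dist_triangle (f a) (f b) (f (b + 1))
    rw [dist_comm (f b)] at h3
    have h4 : (2 ^ b : ℝ)⁻¹ = 2 * (2 ^ (b + 1) : ℝ)⁻¹ := by
      rw [pow_succ]; field_simp
    linarith

theorem exists_lacombeName_of_nbhdName (hlim : HasLimitAlg ν) {G : ℕ → ℕ →. ℕ}
    (hGc : Partrec₂ G) (hG : IsMargin ν G) (hν : ∀ x : X, ∃ n, x ∈ ν n) {u : ℕ → ℕ}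
    (hu : Computable u) {xs : ℕ → X} (hxs : ∀ k, xs k ∈ ν (u k)) (hd : Dense (Set.range xs)) :
    ∃ t : ℕ → ℕ, Computable t ∧ ∀ e O, NbhdName ν O e → LacombeName (ballName ν) (t e) O := by
  obtain ⟨L, hL, hLlim⟩ := hlim
  obtain ⟨ρ, hρc, hρ⟩ := exists_two_pow_names
  have hGdom : ∀ (j n : ℕ) (x y : X) (i : ℕ), x ∈ ν n → y ∈ ν i →
      ((G (Nat.pair n (ρ j)) i).Dom ↔ dist y x < (2 ^ j : ℝ)⁻¹) := fun j n x y i hx hy =>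
    hG.mem_iff (ballName_pair hρ hx j) hy
  obtain ⟨mu, hmuc, hmu⟩ := exists_phi_param (f := fun z i => (phi z i).map u)
    (Partrec.map partrec₂_phi (hu.comp Computable.snd))
  have hQ : Partrec₂ fun e z => (L (mu z)).bind fun m => phi e m :=
    Partrec.bind ((Partrec.nat_iff.2 hL).comp (hmuc.comp Computable.snd))
      (partrec₂_phi.comp (Computable.fst.comp Computable.fst) Computable.snd)
  have hQval : ∀ (e z : ℕ) (O : Set X) (κ : ℕ → ℕ) (x : X), NbhdName ν O e →
      (∀ i, κ i ∈ phi z i) → (∀ k m, k < m → dist (xs (κ k)) (xs (κ m)) < (2 ^ k : ℝ)⁻¹) →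
      Filter.Tendsto (fun i => xs (κ i)) Filter.atTop (nhds x) →
      (((L (mu z)).bind fun m => phi e m).Dom ↔ x ∈ O) ∧
        ∀ j ∈ (L (mu z)).bind fun m => phi e m, Metric.ball x (2 ^ j : ℝ)⁻¹ ⊆ O := by
    intro e z O κ x he hκ hfast hx
    obtain ⟨p, hp, hxp⟩ := hLlim (mu z) (fun k => u (κ k)) (fun k => xs (κ k)) x
      (fun k => by rw [hmu]; exact Part.mem_map _ (hκ k)) (fun k => hxs _)
      (fun k m h => by simpa [zpow_neg] using hfast k m h) hx
    rw [Part.eq_some_iff.2 hp, Part.bind_some]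
    exact he p x hxp
  obtain ⟨s, hs, M, hM, hsM⟩ := exists_phi_freeze hQ
  let step (c a : ℕ) : Part ℕ := (phi c a).bind fun k => (phi c (a + 1)).bind fun k' =>
    G (Nat.pair (u k) (ρ (a + 1))) (u k')
  have hstep : Partrec₂ step := by
    refine Partrec.bind partrec₂_phi ?_
    refine Partrec.bind (partrec₂_phi.comp (Computable.fst.comp Computable.fst)
      (Computable.succ.comp (Computable.snd.comp Computable.fst))) ?_
    exact hGc.comp (Primrec₂.natPair.to_comp.comp (hu.comp (Computable.snd.comp Computable.fst))
      (hρc.comp (Computable.succ.comp (Computable.snd.comp (Computable.fst.comp Computable.fst)))))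
      (hu.comp Computable.snd)
  let V (c m : ℕ) : Part ℕ := Nat.rec (Part.some 0) (fun a IH => IH.bind fun _ => step c a) m
  have hV : Partrec₂ V :=
    partrec_bounded_bind (st := fun p : ℕ × ℕ => step p.1)
      (hstep.comp (Computable.fst.comp Computable.fst) Computable.snd) Computable.snd
  have hE : Partrec₂ fun e c => (M e c).bind fun m => (V c m).bind fun _ => (phi c m).bind fun k =>
      ((L (mu (s e c))).bind fun n => phi e n).map fun j => Nat.pair (u k) (ρ j) := by
    refine Partrec.bind hM ?_
    refine Partrec.bind (hV.comp (Computable.snd.comp Computable.fst) Computable.snd) ?_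
    refine Partrec.bind (partrec₂_phi.comp (Computable.snd.comp (Computable.fst.comp Computable.fst))
      (Computable.snd.comp Computable.fst)) ?_
    have h0 : Computable fun p : (((ℕ × ℕ) × ℕ) × ℕ) × ℕ => p.1.1.1 :=
      Computable.fst.comp (Computable.fst.comp Computable.fst)
    refine Partrec.map (hQ.comp (Computable.fst.comp h0)
      (hs.comp (Computable.fst.comp h0) (Computable.snd.comp h0))) ?_
    exact Primrec₂.natPair.to_comp.comp (hu.comp (Computable.snd.comp Computable.fst))
      (hρc.comp Computable.snd)
  obtain ⟨t, ht, htE⟩ := exists_W_eq_range hE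
  refine ⟨t, ht, fun e O he => ?_⟩
  have sound : ∀ v ∈ W (t e), ∃ B, ballName ν v B ∧ B ⊆ O := by
    intro v hv
    rw [htE] at hv
    obtain ⟨c, hv⟩ := hv
    obtain ⟨m, hm, hv⟩ := Part.mem_bind_iff.1 hv
    obtain ⟨w, hw, hv⟩ := Part.mem_bind_iff.1 hv
    obtain ⟨k, hk, hv⟩ := Part.mem_bind_iff.1 hv
    obtain ⟨j, hj, rfl⟩ := (Part.mem_map_iff _).1 hv
    obtain ⟨-, -, hfr⟩ := hsM e c
    obtain ⟨t₀, hm', hphi⟩ := hfr j hj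
    obtain rfl := Part.mem_unique hm hm'
    have hstepd := (bounded_bind_dom_iff _ _).1 (Part.dom_iff_mem.2 ⟨w, hw⟩)
    have hκ : ∀ a, ∃ k, a ≤ t₀ + j → k ∈ phi c a := by
      intro a
      by_cases ha : a < t₀ + j
      · obtain ⟨k, hk⟩ := Part.dom_iff_mem.1 (Part.bind_dom.1 (hstepd a ha)).1
        exact ⟨k, fun _ => hk⟩
      · exact ⟨k, fun h => by rwa [le_antisymm h (not_lt.1 ha)]⟩
    choose κ hκ using hκ
    have hstepdist : ∀ a < t₀ + j,
        dist (xs (κ (a + 1))) (xs (κ a)) < (2 ^ (a + 1) : ℝ)⁻¹ := by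
      intro a ha
      have h := hstepd a ha
      simp only [step] at h
      rw [Part.eq_some_iff.2 (hκ a (by omega)), Part.bind_some,
        Part.eq_some_iff.2 (hκ (a + 1) (by omega)), Part.bind_some] at h
      exact (hGdom _ _ _ _ _ (hxs _) (hxs _)).1 h
    obtain rfl := Part.mem_unique hk (hκ _ le_rfl)
    refine ⟨_, ballName_pair hρ (hxs _) j, ?_⟩
    refine (hQval e (s e c) O (fun i => κ (if t₀ ≤ i then t₀ + j else i)) _ he (fun i => ?_)
      (fun k m hkm => ?_) ?_).2 j hj
    · rw [hphi]
      exact hκ _ (by split_ifs <;> omega)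
    · have := dist_le_of_dist_succ_lt (f := fun a => xs (κ a)) hstepdist
        (a := if t₀ ≤ k then t₀ + j else k) (b := if t₀ ≤ m then t₀ + j else m)
        (by split_ifs <;> omega) (by split_ifs <;> omega)
      by_cases hk : t₀ ≤ k
      · rw [if_pos hk, if_pos (hk.trans hkm.le), dist_self]
        positivity
      · rw [if_neg hk] at this ⊢
        refine this.trans_lt (sub_lt_self _ (by positivity))
    · refine tendsto_const_nhds.congr' ?_
      filter_upwards [Filter.eventually_ge_atTop t₀] with i hi
      rw [if_pos hi]
  have complete : ∀ x ∈ O, ∃ v ∈ W (t e), ∃ B, ballName ν v B ∧ x ∈ B := by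
    intro x hxO
    obtain ⟨n, hn⟩ := hν x
    have hg : Partrec₂ fun a k => (G (Nat.pair n (ρ (a + 2))) (u k)).map fun _ => k :=
      Partrec.map (hGc.comp (Primrec₂.natPair.to_comp.comp (Computable.const n)
        (hρc.comp (Computable.succ.comp (Computable.succ.comp Computable.fst))))
        (hu.comp Computable.snd)) (Computable.snd.comp Computable.fst)
    obtain ⟨S, hS, hSg⟩ := exists_partrec_search hg
    obtain ⟨c, rfl⟩ := exists_phi_eq hS
    have hκ : ∀ a, ∃ k ∈ phi c a, dist (xs k) x < (2 ^ (a + 2) : ℝ)⁻¹ := by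
      intro a
      obtain ⟨y, ⟨k, rfl⟩, hk⟩ := hd.exists_dist_lt x (ε := (2 ^ (a + 2) : ℝ)⁻¹) (by positivity)
      have hdom : (phi c a).Dom :=
        (hSg a).2 k ((hGdom _ _ _ _ _ hn (hxs k)).2 (by rwa [dist_comm]))
      obtain ⟨k, hk⟩ := Part.dom_iff_mem.1 hdom
      obtain ⟨k', hk'⟩ := (hSg a).1 k hk
      obtain ⟨w, hw, rfl⟩ := (Part.mem_map_iff _).1 hk'
      exact ⟨_, hk, (hGdom _ _ _ _ _ hn (hxs _)).1 (Part.dom_iff_mem.2 ⟨w, hw⟩)⟩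
    choose κ hκ hκx using hκ
    have hpow : ∀ a : ℕ, (2 ^ (a + 1) : ℝ)⁻¹ = (2 ^ a : ℝ)⁻¹ / 2 := fun a => by
      rw [pow_succ]; field_simp
    have hanti : ∀ {a b : ℕ}, a ≤ b → (2 ^ b : ℝ)⁻¹ ≤ (2 ^ a : ℝ)⁻¹ := fun h =>
      inv_anti₀ (by positivity) (pow_le_pow_right₀ one_le_two h)
    obtain ⟨-, hnot, hfr⟩ := hsM e c
    have hdom : ((L (mu (s e c))).bind fun m => phi e m).Dom := by
      by_contra h
      refine h ((hQval e (s e c) O κ x he (fun i => ?_) (fun k m hkm => ?_) ?_).1.2 hxO)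
      · rw [hnot h]; exact hκ i
      · have h1 := hκx k
        have h2 := hκx m
        have h3 := dist_triangle_right (xs (κ k)) (xs (κ m)) x
        have h4 := hanti hkm.le
        have h5 : (0 : ℝ) < (2 ^ k)⁻¹ := by positivity
        rw [hpow, hpow] at h1 h2
        linarith
      · refine tendsto_iff_dist_tendsto_zero.2 (squeeze_zero (fun _ => dist_nonneg)
          (fun i => (hκx i).le) ?_)
        have := (tendsto_pow_atTop_nhds_zero_of_lt_one (r := (2⁻¹ : ℝ)) (by norm_num)
          (by norm_num)).comp (Filter.tendsto_add_atTop_nat 2)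
        simpa [Function.comp_def] using this
    obtain ⟨j, hj⟩ := Part.dom_iff_mem.1 hdom
    obtain ⟨t₀, hm, -⟩ := hfr j hj
    have hVd : (V c (t₀ + j)).Dom := by
      refine (bounded_bind_dom_iff _ _).2 fun a _ => ?_
      simp only [step]
      rw [Part.eq_some_iff.2 (hκ a), Part.bind_some, Part.eq_some_iff.2 (hκ (a + 1)),
        Part.bind_some]
      refine (hGdom _ _ _ _ _ (hxs _) (hxs _)).2 ?_
      have h1 := hκx a
      have h2 := hκx (a + 1)
      have h3 := dist_triangle_right (xs (κ (a + 1))) (xs (κ a)) x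
      have h5 : (0 : ℝ) < (2 ^ a)⁻¹ := by positivity
      rw [hpow, hpow] at h1 h2
      rw [hpow] at h2 ⊢
      linarith
    obtain ⟨w, hw⟩ := Part.dom_iff_mem.1 hVd
    refine ⟨Nat.pair (u (κ (t₀ + j))) (ρ j), ?_, _, ballName_pair hρ (hxs _) j, ?_⟩
    · rw [htE]
      exact ⟨c, Part.mem_bind hm (Part.mem_bind hw (Part.mem_bind (hκ _)
        (Part.mem_map (fun j => Nat.pair (u (κ _)) (ρ j)) hj)))⟩
    · rw [Metric.mem_ball']
      exact (hκx _).trans_le (hanti (by omega))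
  refine ⟨fun k hk => (sound k hk).imp fun _ h => h.1, Set.Subset.antisymm (fun x hx => ?_)
    fun x hx => ?_⟩
  · obtain ⟨v, hv, B, hB, hxB⟩ := complete x hx
    simp only [Set.mem_iUnion]
    exact ⟨v, hv, B, hB, hxB⟩
  · simp only [Set.mem_iUnion] at hx
    obtain ⟨v, hv, B, hB, hxB⟩ := hx
    obtain ⟨B', hB', hsub⟩ := sound v hv
    exact hsub (ballName_unique hB hB' ▸ hxB)

end
/-- **Moschovakis.** Let `(X, ν, d)` be a computable metric space*
with `ν` onto, admitting an algorithm of passage to the limit and a `ν`-computable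
dense sequence. Then the open balls (with their natural numbering) form both a
Lacombe and a Nogina basis, and the two computable topologies they generate are
identical: names can be effectively translated in both directions. -/
theorem moschovakis_nogina_eq_lacombe {X : Type*} [MetricSpace X]
    (ν : ℕ →. X) (hcms : IsCMS ν) (hν : ∀ x : X, ∃ n, x ∈ ν n)
    (hlim : HasLimitAlg ν)
    (hdense : ∃ u : ℕ → ℕ, Computable u ∧ ∃ xs : ℕ → X,
      (∀ k, xs k ∈ ν (u k)) ∧ Dense (Set.range xs)) :
    IsLacombeBasis ν (ballName ν) ∧ IsNoginaBasis ν (ballName ν) ∧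
    (∃ h : ℕ →. ℕ, Nat.Partrec h ∧ ∀ p O, NoginaName ν (ballName ν) p O →
      ∃ i ∈ h p, LacombeName (ballName ν) i O) ∧
    (∃ h : ℕ →. ℕ, Nat.Partrec h ∧ ∀ i O, LacombeName (ballName ν) i O →
      ∃ p ∈ h i, NoginaName ν (ballName ν) p O) := by
  obtain ⟨u, hu, xs, hxs, hd⟩ := hdense
  obtain ⟨G, hGc, hG⟩ := hcms.exists_isMargin
  obtain ⟨ρ, hρc, hρ⟩ := exists_two_pow_names
  obtain ⟨toL, htoLc, htoL⟩ := exists_lacombeName_of_nbhdName hlim hGc hG hν hu hxs hd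
  obtain ⟨toN, htoNc, htoN⟩ := exists_noginaName_of_nbhdName (ν := ν)
  obtain ⟨ofN, hofNc, hofN⟩ := hG.exists_nbhdName_of_noginaName hGc
  obtain ⟨ofL, hofLc, hofL⟩ := hG.exists_nbhdName_of_lacombeName hGc
  obtain ⟨ball, hballc, hball⟩ := hG.exists_nbhdName_ball hGc
  obtain ⟨inter, hinterc, hinter⟩ := exists_nbhdName_inter (ν := ν)
  have hpartrec : ∀ {f : ℕ → ℕ}, Computable f → Nat.Partrec fun n => Part.some (f n) :=
    fun hf => Partrec.nat_iff.1 hf.partrec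
  have hballInter : Computable fun p : ℕ => inter (ball p.unpair.1) (ball p.unpair.2) :=
    hinterc.comp (hballc.comp (Computable.fst.comp Computable.unpair))
      (hballc.comp (Computable.snd.comp Computable.unpair))
  have hsemidec : ∃ F : ℕ →. ℕ, Nat.Partrec F ∧
      ∀ b B, ballName ν b B → ∃ e ∈ F b, SemiDecName ν B e :=
    ⟨_, hpartrec hballc, fun b B hb => ⟨_, Part.mem_some _, (hball b B hb).semiDecName⟩⟩
  refine ⟨⟨fun _ _ _ => ballName_unique, hsemidec, fun x => ?_, ?_, _,
    hpartrec (htoLc.comp hballInter), fun b₁ b₂ B₁ B₂ h₁ h₂ => ⟨_, Part.mem_some _, ?_⟩⟩,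
    ⟨fun _ _ _ => ballName_unique, hsemidec, ⟨_, hpartrec (Primrec₂.natPair.to_comp.comp
      Computable.id (Computable.const (ρ 0))), fun n x hx => ⟨_, Part.mem_some _, _,
        ballName_pair hρ hx 0, Metric.mem_ball_self (by positivity)⟩⟩,
      fun p => phi (toN (inter (ball p.unpair.1.unpair.1) (ball p.unpair.1.unpair.2))).unpair.2
        p.unpair.2, ?_, fun b₁ b₂ B₁ B₂ n x h₁ h₂ hx hx₁ hx₂ => ?_⟩,
    ⟨_, hpartrec (htoLc.comp hofNc), fun p O h => ⟨_, Part.mem_some _, htoL _ _ (hofN p O h)⟩⟩,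
    ⟨_, hpartrec (htoNc.comp hofLc), fun i O h => ⟨_, Part.mem_some _, htoN _ _ (hofL i O h)⟩⟩⟩
  · obtain ⟨n, hn⟩ := hν x
    exact ⟨_, _, ballName_pair hρ hn 0, Metric.mem_ball_self (by positivity)⟩
  · obtain ⟨e, he⟩ := exists_nbhdName_univ (ν := ν)
    exact ⟨_, htoL e _ he⟩
  · rw [Nat.unpair_pair]
    exact htoL _ _ (hinter _ _ _ _ (hball _ _ h₁) (hball _ _ h₂))
  · exact Partrec.nat_iff.1 (partrec₂_phi.comp (Computable.snd.comp (Computable.unpair.comp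
      (htoNc.comp (hballInter.comp (Computable.fst.comp Computable.unpair)))))
      (Computable.snd.comp Computable.unpair))
  · simp only [Nat.unpair_pair]
    exact (htoN _ _ (hinter _ _ _ _ (hball _ _ h₁) (hball _ _ h₂))).2 n x hx ⟨hx₁, hx₂⟩

end T1
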